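/- Suppose n > 24d‖Δ‖_op²/n + 4√(d/n)·‖Δ‖_op·max_{1≤i≤n}‖Δ_i‖_op + max_{1≤i≤n}‖Δ_iᵀG‖_op + ‖Δ‖_op (this is the condition of Theorem 3.1 with δ = 4, since 3δ²/2 = 24). Then the SDP relaxation has a unique global maximizer X̂; moreover X̂ has rank exactly d and X̂ = R̂R̂ᵀ for some R̂ ∈ ℝ^{nd×d} whose d×d blocks are orthogonal matrices and which is a global maximizer of the program (P). -/

import Mathlib

open Matrix MeasureTheory ProbabilityTheory
open scoped BigOperators ENNReal

noncomputable section

/-- Frobenius inner product `⟨X, Y⟩ = Tr (X Yᵀ)`. -/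
def finner {m k : Type*} [Fintype m] [Fintype k] (X Y : Matrix m k ℝ) : ℝ :=
  ∑ i, ∑ j, X i j * Y i j

/-- Frobenius norm. -/
def frobNorm {m k : Type*} [Fintype m] [Fintype k] (X : Matrix m k ℝ) : ℝ :=
  Real.sqrt (∑ i, ∑ j, (X i j) ^ 2)

/-- Spectral (ℓ²-operator) norm of a real matrix. -/
def opNorm {m k : Type*} [Fintype m] [Fintype k] [DecidableEq k] (X : Matrix m k ℝ) : ℝ :=
  ‖LinearMap.toContinuousLinearMap (Matrix.toEuclideanLin X)‖

/-- The `(i,j)` d×d block of an (nd)×(nd) matrix. -/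
def blk {n d : ℕ} (M : Matrix (Fin n × Fin d) (Fin n × Fin d) ℝ) (i j : Fin n) :
    Matrix (Fin d) (Fin d) ℝ := fun k l => M (i, k) (j, l)

/-- The i-th d×p block row of an (nd)×p matrix. -/
def rowBlk {n d p : ℕ} (S : Matrix (Fin n × Fin d) (Fin p) ℝ) (i : Fin n) :
    Matrix (Fin d) (Fin p) ℝ := fun k l => S (i, k) l

/-- The i-th (nd)×d block column of an (nd)×(nd) matrix. -/
def colBlk {n d : ℕ} (M : Matrix (Fin n × Fin d) (Fin n × Fin d) ℝ) (i : Fin n) :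
    Matrix (Fin n × Fin d) (Fin d) ℝ := fun q l => M q (i, l)

/-- All d×p block rows lie in the Stiefel manifold St(d,p) (for p = d: are orthogonal). -/
def StiefelBlocks {n d p : ℕ} (S : Matrix (Fin n × Fin d) (Fin p) ℝ) : Prop :=
  ∀ i, rowBlk S i * (rowBlk S i)ᵀ = 1

/-- The vertical stack Z of n copies of the identity I_d. -/
def Zmat (n d : ℕ) : Matrix (Fin n × Fin d) (Fin d) ℝ := fun q l => if q.2 = l then 1 else 0

/-- Feasibility for the SDP relaxation: symmetric, PSD, identity diagonal blocks. -/
def sdpFeasible {n d : ℕ} (X : Matrix (Fin n × Fin d) (Fin n × Fin d) ℝ) : Prop :=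
  X.IsSymm ∧ X.PosSemidef ∧ ∀ i, blk X i i = 1

/-- Global maximizer of the SDP relaxation with data `A`. -/
def sdpMaximizer {n d : ℕ} (A X : Matrix (Fin n × Fin d) (Fin n × Fin d) ℝ) : Prop :=
  sdpFeasible X ∧ ∀ Y, sdpFeasible Y → finner A Y ≤ finner A X

/-- Global maximizer of the program (P) with data `A`. -/
def progPMaximizer {n d : ℕ} (A : Matrix (Fin n × Fin d) (Fin n × Fin d) ℝ)
    (R : Matrix (Fin n × Fin d) (Fin d) ℝ) : Prop :=
  StiefelBlocks R ∧
    ∀ R' : Matrix (Fin n × Fin d) (Fin d) ℝ, StiefelBlocks R' →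
      finner A (R' * R'ᵀ) ≤ finner A (R * Rᵀ)

/-- The distance `d_F(S, Z) = min_{Q ∈ St(d,p)} ‖S − ZQ‖_F`. -/
def dF {n d p : ℕ} (S : Matrix (Fin n × Fin d) (Fin p) ℝ) : ℝ :=
  sInf {c | ∃ Q : Matrix (Fin d) (Fin p) ℝ, Q * Qᵀ = 1 ∧ c = frobNorm (S - Zmat n d * Q)}

/-- `Λ_{ii}(S) = (1/2) Σ_j (S_i S_jᵀ A_{ji} + A_{ij} S_j S_iᵀ)`. -/
def Lam {n d p : ℕ} (A : Matrix (Fin n × Fin d) (Fin n × Fin d) ℝ)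
    (S : Matrix (Fin n × Fin d) (Fin p) ℝ) (i : Fin n) : Matrix (Fin d) (Fin d) ℝ :=
  (1 / 2 : ℝ) •
    ∑ j, (rowBlk S i * (rowBlk S j)ᵀ * blk A j i + blk A i j * rowBlk S j * (rowBlk S i)ᵀ)

/-- Block diagonal matrix with given d×d diagonal blocks. -/
def blkDiag {n d : ℕ} (D : Fin n → Matrix (Fin d) (Fin d) ℝ) :
    Matrix (Fin n × Fin d) (Fin n × Fin d) ℝ :=
  fun q r => if q.1 = r.1 then D q.1 q.2 r.2 else 0

/-- Local maximizer of `f(S) = ⟨A, S Sᵀ⟩` over `St(d,p)^{⊗n}`. -/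
def isLocalMax {n d p : ℕ} (A : Matrix (Fin n × Fin d) (Fin n × Fin d) ℝ)
    (S : Matrix (Fin n × Fin d) (Fin p) ℝ) : Prop :=
  StiefelBlocks S ∧ ∃ ε > (0 : ℝ), ∀ S' : Matrix (Fin n × Fin d) (Fin p) ℝ,
    StiefelBlocks S' → frobNorm (S' - S) < ε → finner A (S' * S'ᵀ) ≤ finner A (S * Sᵀ)

/-- First-order criticality: `Σ_j A_{ij} S_j = Λ_{ii}(S) S_i` for all i. -/
def firstOrderCrit {n d p : ℕ} (A : Matrix (Fin n × Fin d) (Fin n × Fin d) ℝ)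
    (S : Matrix (Fin n × Fin d) (Fin p) ℝ) : Prop :=
  ∀ i, (∑ j, blk A i j * rowBlk S j) = Lam A S i * rowBlk S i

/-- Second-order necessary inequality over tangent directions. -/
def secondOrderIneq {n d p : ℕ} (A : Matrix (Fin n × Fin d) (Fin n × Fin d) ℝ)
    (S : Matrix (Fin n × Fin d) (Fin p) ℝ) : Prop :=
  ∀ Y : Matrix (Fin n × Fin d) (Fin p) ℝ,
    (∀ i, rowBlk S i * (rowBlk Y i)ᵀ + rowBlk Y i * (rowBlk S i)ᵀ = 0) →
    ∑ i, ∑ j, finner (blk A i j) (rowBlk Y i * (rowBlk Y j)ᵀ) ≤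
      ∑ i, finner (Lam A S i) (rowBlk Y i * (rowBlk Y i)ᵀ)

/-- Second-order critical point of `f`. -/
def secondOrderCrit {n d p : ℕ} (A : Matrix (Fin n × Fin d) (Fin n × Fin d) ℝ)
    (S : Matrix (Fin n × Fin d) (Fin p) ℝ) : Prop :=
  StiefelBlocks S ∧ firstOrderCrit A S ∧ secondOrderIneq A S

/-- Partial trace `Tr_d(Δ) ∈ ℝ^{n×n}`. -/
def partialTrace {n d : ℕ} (Δ : Matrix (Fin n × Fin d) (Fin n × Fin d) ℝ) :
    Matrix (Fin n) (Fin n) ℝ := fun i j => (blk Δ i j).trace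

/-- Singular values of a d×p real matrix (square roots of the eigenvalues of `M Mᴴ`). -/
def singVals {d p : ℕ} (M : Matrix (Fin d) (Fin p) ℝ) (i : Fin d) : ℝ :=
  Real.sqrt ((Matrix.isHermitian_mul_conjTranspose_self M).eigenvalues i)

/-- Nuclear norm: sum of singular values. -/
def nuclearNorm {d p : ℕ} (M : Matrix (Fin d) (Fin p) ℝ) : ℝ :=
  ∑ i, singVals M i

/-- The law of the iid standard Gaussian coordinates indexing the noise. -/
def gaussianEnsemble (n d : ℕ) :
    Measure (((Fin n × Fin d) × (Fin n × Fin d)) → ℝ) :=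
  Measure.pi fun _ => gaussianReal 0 1

/-- The symmetric Gaussian random matrix `W` built from the iid coordinates:
`W_{ii} = 0`, the entries of `W_{ij}` for `i < j` are iid standard Gaussians, and
`W_{ji} = W_{ij}ᵀ`. -/
def Wof {n d : ℕ} (ω : ((Fin n × Fin d) × (Fin n × Fin d)) → ℝ) :
    Matrix (Fin n × Fin d) (Fin n × Fin d) ℝ :=
  fun q r => if q.1 < r.1 then ω (q, r) else if r.1 < q.1 then ω (r, q) else 0

/-- Euclidean norm of a coordinate vector. -/
def vnorm {m : Type*} [Fintype m] (x : m → ℝ) : ℝ := ‖WithLp.toLp 2 x‖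

lemma vnorm_nonneg {m : Type*} [Fintype m] (x : m → ℝ) : 0 ≤ vnorm x := norm_nonneg _

lemma vnorm_sq {m : Type*} [Fintype m] (x : m → ℝ) : vnorm x ^ 2 = x ⬝ᵥ x := by
  rw [vnorm, EuclideanSpace.norm_sq_eq]
  simp [dotProduct, sq]

lemma dotProduct_le_vnorm {m : Type*} [Fintype m] (x y : m → ℝ) :
    x ⬝ᵥ y ≤ vnorm x * vnorm y := by
  have h := real_inner_le_norm (WithLp.toLp 2 x) (WithLp.toLp 2 y)
  rw [EuclideanSpace.inner_toLp_toLp] at h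
  simpa [vnorm, dotProduct_comm] using h

lemma vnorm_add_le {m : Type*} [Fintype m] (x y : m → ℝ) :
    vnorm (x + y) ≤ vnorm x + vnorm y :=
  norm_add_le (WithLp.toLp 2 x) (WithLp.toLp 2 y)

lemma vnorm_neg {m : Type*} [Fintype m] (x : m → ℝ) : vnorm (-x) = vnorm x :=
  norm_neg (WithLp.toLp 2 x)

lemma vnorm_mulVec_le {m k : Type*} [Fintype m] [Fintype k] [DecidableEq k]
    (X : Matrix m k ℝ) (x : k → ℝ) : vnorm (X *ᵥ x) ≤ opNorm X * vnorm x := by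
  have h := (LinearMap.toContinuousLinearMap (Matrix.toEuclideanLin X)).le_opNorm (WithLp.toLp 2 x)
  simpa [vnorm, opNorm] using h

lemma opNorm_nonneg {m k : Type*} [Fintype m] [Fintype k] [DecidableEq k]
    (X : Matrix m k ℝ) : 0 ≤ opNorm X := norm_nonneg _

lemma vnorm_transpose_mulVec_le {m k : Type*} [Fintype m] [Fintype k] [DecidableEq k]
    (X : Matrix m k ℝ) (y : m → ℝ) : vnorm (Xᵀ *ᵥ y) ≤ opNorm X * vnorm y := by
  have h1 : vnorm (Xᵀ *ᵥ y) ^ 2 ≤ vnorm y * (opNorm X * vnorm (Xᵀ *ᵥ y)) := by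
    rw [vnorm_sq]
    calc (Xᵀ *ᵥ y) ⬝ᵥ (Xᵀ *ᵥ y) = y ⬝ᵥ (X *ᵥ (Xᵀ *ᵥ y)) := by
          rw [dotProduct_mulVec y, ← mulVec_transpose]
      _ ≤ _ := (dotProduct_le_vnorm _ _).trans
          (mul_le_mul_of_nonneg_left (vnorm_mulVec_le _ _) (vnorm_nonneg _))
  by_contra! h
  nlinarith [vnorm_nonneg (Xᵀ *ᵥ y), mul_nonneg (opNorm_nonneg X) (vnorm_nonneg y)]

lemma finner_eq_trace {m k : Type*} [Fintype m] [Fintype k] (X Y : Matrix m k ℝ) :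
    finner X Y = (X * Yᵀ).trace := by
  simp [finner, trace, mul_apply]

lemma frobNorm_nonneg {m k : Type*} [Fintype m] [Fintype k] (X : Matrix m k ℝ) :
    0 ≤ frobNorm X := Real.sqrt_nonneg _

lemma frobNorm_sq {m k : Type*} [Fintype m] [Fintype k] (X : Matrix m k ℝ) :
    frobNorm X ^ 2 = ∑ i, ∑ j, X i j ^ 2 :=
  Real.sq_sqrt (Finset.sum_nonneg fun _ _ => Finset.sum_nonneg fun _ _ => sq_nonneg _)

lemma frobNorm_sq_eq_trace {m k : Type*} [Fintype m] [Fintype k] (X : Matrix m k ℝ) :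
    frobNorm X ^ 2 = (Xᵀ * X).trace := by
  rw [frobNorm_sq, Finset.sum_comm]
  simp [trace, mul_apply, sq]

lemma frobNorm_transpose {m k : Type*} [Fintype m] [Fintype k] (X : Matrix m k ℝ) :
    frobNorm Xᵀ = frobNorm X := by
  rw [frobNorm, frobNorm, Finset.sum_comm]
  rfl

lemma trace_transpose_mul_le_frobNorm {m k : Type*} [Fintype m] [Fintype k]
    (X Y : Matrix m k ℝ) : (Xᵀ * Y).trace ≤ frobNorm X * frobNorm Y := by
  have h := Finset.sum_mul_sq_le_sq_mul_sq (Finset.univ : Finset (m × k))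
    (fun p => X p.1 p.2) (fun p => Y p.1 p.2)
  simp only [Fintype.sum_prod_type] at h
  rw [← frobNorm_sq, ← frobNorm_sq, ← mul_pow] at h
  have h2 : (Xᵀ * Y).trace = ∑ i, ∑ j, X i j * Y i j := by
    rw [Finset.sum_comm]
    simp [trace, mul_apply]
  rw [h2]
  exact le_of_sq_le_sq h (mul_nonneg (frobNorm_nonneg _) (frobNorm_nonneg _))

lemma frobNorm_mul_le {m k l : Type*} [Fintype m] [Fintype k] [Fintype l] [DecidableEq k]
    (X : Matrix m k ℝ) (Y : Matrix k l ℝ) : frobNorm (X * Y) ≤ opNorm X * frobNorm Y := by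
  refine le_of_sq_le_sq ?_ (mul_nonneg (opNorm_nonneg _) (frobNorm_nonneg _))
  rw [mul_pow, frobNorm_sq (X * Y), frobNorm_sq Y, Finset.sum_comm,
    Finset.sum_comm (f := fun i j => Y i j ^ 2), Finset.mul_sum]
  refine Finset.sum_le_sum fun j _ => ?_
  have h := pow_le_pow_left₀ (vnorm_nonneg _) (vnorm_mulVec_le X (fun i => Y i j)) 2
  rw [mul_pow, vnorm_sq, vnorm_sq] at h
  simpa [dotProduct, mulVec, mul_apply, sq] using h

lemma vnorm_mulVec_le_frobNorm {m k : Type*} [Fintype m] [Fintype k]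
    (X : Matrix m k ℝ) (x : k → ℝ) : vnorm (X *ᵥ x) ≤ frobNorm X * vnorm x := by
  refine le_of_sq_le_sq ?_ (mul_nonneg (frobNorm_nonneg _) (vnorm_nonneg _))
  rw [mul_pow, frobNorm_sq, vnorm_sq, vnorm_sq, Finset.sum_mul]
  refine Finset.sum_le_sum fun i _ => ?_
  have h := Finset.sum_mul_sq_le_sq_mul_sq Finset.univ (X i) x
  simpa [dotProduct, mulVec, sq] using h

lemma trace_mul_nonneg_of_posSemidef {m : Type*} [Fintype m] [DecidableEq m]
    {M N : Matrix m m ℝ} (hM : M.PosSemidef) (hN : N.PosSemidef) : 0 ≤ (M * N).trace := by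
  open scoped MatrixOrder in
  obtain ⟨B, rfl⟩ := CStarAlgebra.nonneg_iff_eq_star_mul_self.mp hM.nonneg
  rw [star_eq_conjTranspose]
  rw [Matrix.mul_assoc, trace_mul_comm]
  exact (hN.mul_mul_conjTranspose_same B).trace_nonneg

lemma isHermitian_iff_transpose {m : Type*} (M : Matrix m m ℝ) : M.IsHermitian ↔ Mᵀ = M := by
  rw [IsHermitian, conjTranspose_eq_transpose_of_trivial]

/-- A positive semidefinite matrix that expands lengths by at least `c` is at least `c • 1`. -/
lemma PosSemidef.le_dotProduct_mulVec_of_le_vnorm {m : Type*} [Fintype m] [DecidableEq m]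
    {N : Matrix m m ℝ} (hN : N.PosSemidef) {c : ℝ} (h : ∀ x, c * vnorm x ≤ vnorm (N *ᵥ x))
    (x : m → ℝ) : c * (x ⬝ᵥ x) ≤ x ⬝ᵥ (N *ᵥ x) := by
  have hH : (N - c • (1 : Matrix m m ℝ)).IsHermitian := by
    rw [isHermitian_iff_transpose]
    simp [(isHermitian_iff_transpose N).1 hN.1]
  have key : (N - c • (1 : Matrix m m ℝ)).PosSemidef := by
    rw [hH.posSemidef_iff_eigenvalues_nonneg]
    intro j
    set v : m → ℝ := (hH.eigenvectorBasis j).ofLp with hv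
    have hv1 : vnorm v = 1 := by
      rw [vnorm, hv]
      exact hH.eigenvectorBasis.orthonormal.1 j
    have e := hH.mulVec_eigenvectorBasis j
    rw [← hv] at e
    have e2 : N *ᵥ v = (hH.eigenvalues j + c) • v := by
      rw [sub_mulVec, smul_mulVec, one_mulVec] at e
      rw [add_smul, ← e]
      simp
    have h1 := h v
    have h2 := hN.dotProduct_mulVec_nonneg v
    have hvv : v ⬝ᵥ v = 1 := by rw [← vnorm_sq, hv1, one_pow]
    have h3 : 0 ≤ hH.eigenvalues j + c := by
      simpa [e2, hvv] using h2
    have h4 : vnorm (N *ᵥ v) = hH.eigenvalues j + c := by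
      have : vnorm (N *ᵥ v) ^ 2 = (hH.eigenvalues j + c) ^ 2 := by
        rw [vnorm_sq, e2]
        simp [hvv, sq]
      exact (pow_left_inj₀ (vnorm_nonneg _) h3 two_ne_zero).1 this
    rw [h4, hv1] at h1
    simp
    linarith
  have := key.dotProduct_mulVec_nonneg x
  simp [sub_mulVec, smul_mulVec, dotProduct_sub] at this
  linarith

/-- The reflection in `u` is orthogonal. -/
lemma reflection_mul_transpose {m : Type*} [Fintype m] [DecidableEq m] (u : m → ℝ)
    (hu : u ⬝ᵥ u ≠ 0) :
    (1 - (2 / (u ⬝ᵥ u)) • vecMulVec u u) * (1 - (2 / (u ⬝ᵥ u)) • vecMulVec u u)ᵀ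
      = (1 : Matrix m m ℝ) := by
  have h1 : (vecMulVec u u)ᵀ = vecMulVec u u := by
    ext i j
    simp [vecMulVec_apply, mul_comm]
  have h2 : vecMulVec u u * vecMulVec u u = (u ⬝ᵥ u) • vecMulVec u u := by
    rw [vecMulVec_mul_vecMulVec]
    ext i j
    simp [vecMulVec_apply]
    ring
  rw [transpose_sub, transpose_smul, h1, transpose_one, sub_mul, mul_sub, mul_sub, smul_mul_smul,
    h2, smul_smul, Matrix.one_mul, Matrix.mul_one, Matrix.one_mul]
  have h3 : 2 / (u ⬝ᵥ u) * (2 / (u ⬝ᵥ u)) * (u ⬝ᵥ u) = 2 / (u ⬝ᵥ u) + 2 / (u ⬝ᵥ u) := by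
    field_simp
    norm_num
  rw [h3, add_smul]
  abel

lemma trace_mul_vecMulVec' {m : Type*} [Fintype m] (N : Matrix m m ℝ) (u v : m → ℝ) :
    (N * vecMulVec u v).trace = v ⬝ᵥ (N *ᵥ u) := by
  rw [mul_vecMulVec, trace_vecMulVec, dotProduct_comm]

/-- If the trace of `N * O`, over orthogonal `O`, is largest at `O = 1`, then `N` is positive
semidefinite. -/
lemma posSemidef_of_trace_mul_le {m : Type*} [Fintype m] [DecidableEq m] {N : Matrix m m ℝ}
    (h : ∀ O : Matrix m m ℝ, O * Oᵀ = 1 → (N * O).trace ≤ N.trace) : N.PosSemidef := by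
  have hnn : ∀ u : m → ℝ, 0 ≤ u ⬝ᵥ (N *ᵥ u) := by
    intro u
    by_cases hu : u ⬝ᵥ u = 0
    · rw [dotProduct_self_eq_zero.1 hu]
      simp
    have hpos : 0 < u ⬝ᵥ u := lt_of_le_of_ne (by rw [← vnorm_sq]; positivity) (Ne.symm hu)
    have h1 := h _ (reflection_mul_transpose u hu)
    rw [Matrix.mul_sub, Matrix.mul_one, Matrix.mul_smul, trace_sub, trace_smul,
      trace_mul_vecMulVec', smul_eq_mul] at h1
    by_contra! h2
    have : 2 / (u ⬝ᵥ u) * (u ⬝ᵥ (N *ᵥ u)) < 0 := mul_neg_of_pos_of_neg (by positivity) h2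
    linarith
  have hpair : ∀ u v : m → ℝ, 2 * (u ⬝ᵥ v) * (v ⬝ᵥ (N *ᵥ u)) ≤
      (v ⬝ᵥ v) * (u ⬝ᵥ (N *ᵥ u)) + (u ⬝ᵥ u) * (v ⬝ᵥ (N *ᵥ v)) := by
    intro u v
    by_cases hu : u ⬝ᵥ u = 0
    · rw [dotProduct_self_eq_zero.1 hu]
      simp
    by_cases hv : v ⬝ᵥ v = 0
    · rw [dotProduct_self_eq_zero.1 hv]
      simp
    have hpu : 0 < u ⬝ᵥ u := lt_of_le_of_ne (by rw [← vnorm_sq]; positivity) (Ne.symm hu)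
    have hpv : 0 < v ⬝ᵥ v := lt_of_le_of_ne (by rw [← vnorm_sq]; positivity) (Ne.symm hv)
    have h1 := h ((1 - (2 / (u ⬝ᵥ u)) • vecMulVec u u) * (1 - (2 / (v ⬝ᵥ v)) • vecMulVec v v)) (by
      rw [transpose_mul, Matrix.mul_assoc, ← Matrix.mul_assoc _ _ (_ : Matrix m m ℝ)ᵀ,
        reflection_mul_transpose v hv, Matrix.one_mul, reflection_mul_transpose u hu])
    simp only [Matrix.sub_mul, Matrix.mul_sub, Matrix.mul_one, Matrix.one_mul, Matrix.smul_mul,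
      vecMulVec_mul_vecMulVec, Matrix.mul_smul, trace_sub, trace_smul, trace_mul_vecMulVec',
      smul_eq_mul, smul_dotProduct] at h1
    have h2 := mul_le_mul_of_nonneg_left h1 (mul_pos hpu hpv).le
    field_simp at h2
    linarith
  refine .of_dotProduct_mulVec_nonneg ?_ (fun u => by simpa using hnn u)
  have hsymm : ∀ u w : m → ℝ, w ⬝ᵥ (N *ᵥ u) = u ⬝ᵥ (N *ᵥ w) := by
    intro u w
    by_cases hu : u ⬝ᵥ u = 0
    · rw [dotProduct_self_eq_zero.1 hu]
      simp
    have hpu : 0 < u ⬝ᵥ u := lt_of_le_of_ne (by rw [← vnorm_sq]; positivity) (Ne.symm hu)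
    set a := (u ⬝ᵥ u) * (w ⬝ᵥ (N *ᵥ u) - u ⬝ᵥ (N *ᵥ w)) with ha
    set b := 2 * (u ⬝ᵥ w) * (w ⬝ᵥ (N *ᵥ u)) - (w ⬝ᵥ w) * (u ⬝ᵥ (N *ᵥ u))
      - (u ⬝ᵥ u) * (w ⬝ᵥ (N *ᵥ w)) with hb
    have key : ∀ t : ℝ, a * t + b * t ^ 2 ≤ 0 := by
      intro t
      have := hpair u (u + t • w)
      simp only [mulVec_add, mulVec_smul, dotProduct_add, add_dotProduct, smul_dotProduct,
        dotProduct_smul, smul_eq_mul, dotProduct_comm w u] at this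
      rw [ha, hb]
      linarith
    have ha0 : a = 0 := by
      by_contra hne
      have h1 := key (a / (1 + |b|))
      have hb1 : 0 < 1 + |b| := by positivity
      have h2 : a * (a / (1 + |b|)) + b * (a / (1 + |b|)) ^ 2
          = a ^ 2 * (1 + |b| + b) / (1 + |b|) ^ 2 := by
        field_simp
      rw [h2] at h1
      have h3 : 0 < 1 + |b| + b := by linarith [neg_abs_le b]
      have : 0 < a ^ 2 * (1 + |b| + b) / (1 + |b|) ^ 2 := by positivity
      linarith
    rcases mul_eq_zero.1 ha0 with h1 | h1
    · exact absurd h1 hu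
    · linarith
  rw [isHermitian_iff_transpose]
  ext i j
  simpa using (hsymm (Pi.single i 1) (Pi.single j 1))

lemma isCompact_mul_transpose_eq_one (d : ℕ) :
    IsCompact {O : Matrix (Fin d) (Fin d) ℝ | O * Oᵀ = 1} := by
  have hbox : IsCompact (Set.univ.pi fun _ : Fin d => Set.univ.pi fun _ : Fin d =>
      Set.Icc (-1 : ℝ) 1) :=
    isCompact_univ_pi fun _ => isCompact_univ_pi fun _ => isCompact_Icc
  have hmem : ∀ O : Matrix (Fin d) (Fin d) ℝ, O * Oᵀ = 1 → ∀ i j, O i j ∈ Set.Icc (-1 : ℝ) 1 := by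
    intro O hO i j
    have h := congrFun (congrFun hO i) i
    rw [mul_apply, one_apply_eq] at h
    have h2 : O i j * O i j ≤ 1 := by
      rw [← h]
      exact Finset.single_le_sum (f := fun k => O i k * Oᵀ k i)
        (fun k _ => mul_self_nonneg (O i k)) (Finset.mem_univ j)
    exact abs_le.1 (abs_le_one_iff_mul_self_le_one.2 h2)
  refine IsCompact.of_isClosed_subset (X := Fin d → Fin d → ℝ) hbox ?_
    fun O hO i _ j _ => hmem O hO i j
  exact isClosed_eq (X := Matrix (Fin d) (Fin d) ℝ)
    (continuous_id.matrix_mul continuous_id.matrix_transpose) continuous_const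

/-- Polar decomposition: `M * Qᵀ` is positive semidefinite for some orthogonal `Q`. -/
lemma exists_orthogonal_posSemidef {d : ℕ} (M : Matrix (Fin d) (Fin d) ℝ) :
    ∃ Q : Matrix (Fin d) (Fin d) ℝ, Q * Qᵀ = 1 ∧ (M * Qᵀ).PosSemidef := by
  obtain ⟨Q, hQ, hmax⟩ := (isCompact_mul_transpose_eq_one d).exists_isMaxOn
    ⟨1, by simp⟩ (f := fun O => (M * Oᵀ).trace)
    (continuous_const.matrix_mul continuous_id.matrix_transpose).matrix_trace.continuousOn
  refine ⟨Q, hQ, posSemidef_of_trace_mul_le fun O hO => ?_⟩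
  have := hmax (a := Oᵀ * Q) (by
    have hO' : Oᵀ * O = 1 := mul_eq_one_comm.1 hO
    have hQ' : Q * Qᵀ = 1 := hQ
    show Oᵀ * Q * (Oᵀ * Q)ᵀ = 1
    rw [transpose_mul, transpose_transpose, Matrix.mul_assoc, ← Matrix.mul_assoc Q, hQ',
      Matrix.one_mul, hO'])
  simpa [Matrix.mul_assoc] using this

/-- The `i`-th block column of the identity matrix. -/
def blkIncl (n d : ℕ) (i : Fin n) : Matrix (Fin n × Fin d) (Fin d) ℝ :=
  fun q l => if q = (i, l) then 1 else 0

section Blocks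

variable {n d p : ℕ}

lemma blkIncl_transpose_mul_apply {c : Type*} (S : Matrix (Fin n × Fin d) c ℝ) (i : Fin n)
    (k : Fin d) (l : c) : ((blkIncl n d i)ᵀ * S) k l = S (i, k) l := by
  simp [mul_apply, blkIncl]

lemma blkIncl_transpose_mul (S : Matrix (Fin n × Fin d) (Fin p) ℝ) (i : Fin n) :
    (blkIncl n d i)ᵀ * S = rowBlk S i := by
  ext k l
  exact blkIncl_transpose_mul_apply S i k l

lemma mul_blkIncl (M : Matrix (Fin n × Fin d) (Fin n × Fin d) ℝ) (i : Fin n) :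
    M * blkIncl n d i = colBlk M i := by
  ext q l
  simp [mul_apply, blkIncl, colBlk]

lemma blkIncl_transpose_mul_mul (M : Matrix (Fin n × Fin d) (Fin n × Fin d) ℝ) (i j : Fin n) :
    (blkIncl n d i)ᵀ * M * blkIncl n d j = blk M i j := by
  rw [Matrix.mul_assoc, mul_blkIncl, blkIncl_transpose_mul]
  rfl

lemma blkIncl_transpose_mul_self (i : Fin n) :
    (blkIncl n d i)ᵀ * blkIncl n d i = 1 := by
  ext k l
  rw [blkIncl_transpose_mul_apply]
  simp [blkIncl, one_apply]

lemma sum_blkIncl_mul_transpose : ∑ i, blkIncl n d i * (blkIncl n d i)ᵀ = 1 := by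
  ext ⟨a, b⟩ ⟨a', b'⟩
  rw [Matrix.sum_apply]
  simp only [mul_apply, blkIncl, transpose_apply, one_apply, Prod.mk.injEq]
  rw [Finset.sum_eq_single a]
  · rw [Finset.sum_eq_single b]
    · simp [eq_comm]
    · intro c _ hc
      simp [hc.symm]
    · simp
  · intro i _ hi
    simp [hi.symm]
  · simp

lemma StiefelBlocks.transpose_mul_self {S : Matrix (Fin n × Fin d) (Fin d) ℝ}
    (hS : StiefelBlocks S) : Sᵀ * S = (n : ℝ) • (1 : Matrix (Fin d) (Fin d) ℝ) := by
  have h : Sᵀ * (1 : Matrix (Fin n × Fin d) (Fin n × Fin d) ℝ) * S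
      = ∑ i, (rowBlk S i)ᵀ * rowBlk S i := by
    rw [← sum_blkIncl_mul_transpose, Matrix.mul_sum, Matrix.sum_mul]
    refine Finset.sum_congr rfl fun i _ => ?_
    rw [← blkIncl_transpose_mul, transpose_mul, transpose_transpose]
    simp only [Matrix.mul_assoc]
  rw [Matrix.mul_one] at h
  rw [h, Finset.sum_congr rfl fun i _ => mul_eq_one_comm.1 (hS i)]
  simp [← Nat.cast_smul_eq_nsmul ℝ]

lemma StiefelBlocks.mul_right {S : Matrix (Fin n × Fin d) (Fin d) ℝ} (hS : StiefelBlocks S)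
    {Q : Matrix (Fin d) (Fin d) ℝ} (hQ : Q * Qᵀ = 1) : StiefelBlocks (S * Q) := by
  intro i
  rw [← blkIncl_transpose_mul, ← Matrix.mul_assoc, blkIncl_transpose_mul, transpose_mul,
    Matrix.mul_assoc, ← Matrix.mul_assoc Q, hQ, Matrix.one_mul, hS i]

lemma progPMaximizer.mul_right {A : Matrix (Fin n × Fin d) (Fin n × Fin d) ℝ}
    {R : Matrix (Fin n × Fin d) (Fin d) ℝ} (hR : progPMaximizer A R)
    {Q : Matrix (Fin d) (Fin d) ℝ} (hQ : Q * Qᵀ = 1) : progPMaximizer A (R * Q) := by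
  refine ⟨hR.1.mul_right hQ, ?_⟩
  rw [transpose_mul, Matrix.mul_assoc, ← Matrix.mul_assoc Q, hQ, Matrix.one_mul]
  exact hR.2

lemma exists_progPMaximizer (A : Matrix (Fin n × Fin d) (Fin n × Fin d) ℝ) :
    ∃ R : Matrix (Fin n × Fin d) (Fin d) ℝ, progPMaximizer A R := by
  have hK : IsCompact (Set.univ.pi fun _ : Fin n =>
      {O : Matrix (Fin d) (Fin d) ℝ | O * Oᵀ = 1}) :=
    isCompact_univ_pi fun _ => isCompact_mul_transpose_eq_one d
  let stack : (Fin n → Matrix (Fin d) (Fin d) ℝ) → Matrix (Fin n × Fin d) (Fin d) ℝ :=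
    fun f q l => f q.1 q.2 l
  have hcont : Continuous stack := by
    refine continuous_matrix fun q l => ?_
    exact (continuous_apply q.1).matrix_elem q.2 l
  have hobj : Continuous fun f => finner A (stack f * (stack f)ᵀ) := by
    simp only [finner_eq_trace]
    exact (continuous_const.matrix_mul
      (hcont.matrix_mul hcont.matrix_transpose).matrix_transpose).matrix_trace
  obtain ⟨f, hf, hmax⟩ := hK.exists_isMaxOn ⟨fun _ => 1, fun i _ => by simp⟩ hobj.continuousOn
  exact ⟨stack f, fun i => hf i trivial, fun R' hR' =>
    hmax (a := fun i => rowBlk R' i) fun i _ => hR' i⟩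

/-- A global maximizer of (P) can be aligned with `G`. -/
lemma exists_aligned_progPMaximizer (A : Matrix (Fin n × Fin d) (Fin n × Fin d) ℝ)
    (G : Matrix (Fin n × Fin d) (Fin d) ℝ) :
    ∃ R : Matrix (Fin n × Fin d) (Fin d) ℝ, progPMaximizer A R ∧ (Gᵀ * R).PosSemidef := by
  obtain ⟨R, hR⟩ := exists_progPMaximizer A
  obtain ⟨Q, hQ, hP⟩ := exists_orthogonal_posSemidef (Gᵀ * R)
  refine ⟨R * Qᵀ, hR.mul_right ?_, by rwa [← Matrix.mul_assoc]⟩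
  rw [transpose_transpose]
  exact mul_eq_one_comm.1 hQ

/-- Optimality in a single block makes the corresponding multiplier positive semidefinite. -/
lemma progPMaximizer.posSemidef_rowBlk_mul {A : Matrix (Fin n × Fin d) (Fin n × Fin d) ℝ}
    (hA : A.IsSymm) {i : Fin n} (hAi : blk A i i = 1)
    {R : Matrix (Fin n × Fin d) (Fin d) ℝ} (hR : progPMaximizer A R) :
    (rowBlk (A * R) i * (rowBlk R i)ᵀ).PosSemidef := by
  set N := rowBlk (A * R) i * (rowBlk R i)ᵀ with hN
  suffices h : (N - 1).PosSemidef by simpa using h.add PosSemidef.one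
  refine posSemidef_of_trace_mul_le fun O hO => ?_
  set J := blkIncl n d i with hJ
  set V := Oᵀ * rowBlk R i - rowBlk R i with hV
  have hRi := hR.1 i
  have hO' : Oᵀ * O = 1 := mul_eq_one_comm.1 hO
  have hst : StiefelBlocks (R + J * V) := by
    intro j
    by_cases hji : j = i
    · subst hji
      rw [← blkIncl_transpose_mul, Matrix.mul_add, ← Matrix.mul_assoc, hJ,
        blkIncl_transpose_mul_self, blkIncl_transpose_mul, Matrix.one_mul, hV,
        add_sub_cancel, transpose_mul, transpose_transpose, Matrix.mul_assoc,
        ← Matrix.mul_assoc (rowBlk R j), hRi, Matrix.one_mul, hO']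
    · have h0 : (blkIncl n d j)ᵀ * J = 0 := by
        ext k l
        rw [blkIncl_transpose_mul_apply]
        simp [hJ, blkIncl, hji]
      rw [← blkIncl_transpose_mul, Matrix.mul_add, ← Matrix.mul_assoc, h0, Matrix.zero_mul,
        add_zero, blkIncl_transpose_mul]
      exact hR.1 j
  have hle := hR.2 _ hst
  have hVV : (V * Vᵀ).trace = 2 * (1 : Matrix (Fin d) (Fin d) ℝ).trace - 2 * O.trace := by
    have : V * Vᵀ = (Oᵀ - 1) * (rowBlk R i * (rowBlk R i)ᵀ) * (O - 1) := by
      have : V = (Oᵀ - 1) * rowBlk R i := by rw [hV, Matrix.sub_mul, Matrix.one_mul]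
      rw [this, transpose_mul, transpose_sub, transpose_transpose, transpose_one]
      simp only [Matrix.mul_assoc]
    rw [this, hRi, Matrix.mul_one, Matrix.sub_mul, Matrix.mul_sub, hO', Matrix.one_mul,
      Matrix.mul_one, trace_sub, trace_sub, trace_sub, trace_transpose]
    ring
  have hcross : (A * R * (J * V)ᵀ).trace = (N * O).trace - N.trace := by
    have h1 : (J * V)ᵀ = Vᵀ * Jᵀ := transpose_mul _ _
    have h2 : Vᵀ = (rowBlk R i)ᵀ * (O - 1) := by
      rw [hV, transpose_sub, transpose_mul, transpose_transpose, Matrix.mul_sub, Matrix.mul_one]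
    rw [h1, ← Matrix.mul_assoc, trace_mul_comm, ← Matrix.mul_assoc, hJ, blkIncl_transpose_mul,
      h2, ← Matrix.mul_assoc, ← hN, Matrix.mul_sub, trace_sub, Matrix.mul_one]
  have hcross' : (A * (J * V) * Rᵀ).trace = (A * R * (J * V)ᵀ).trace := by
    rw [← trace_transpose, transpose_mul, transpose_mul, transpose_transpose, hA.eq,
      ← Matrix.mul_assoc, trace_mul_comm, ← Matrix.mul_assoc]
  have hquad : (A * (J * V) * (J * V)ᵀ).trace = (V * Vᵀ).trace := by
    have h1 : (J * V)ᵀ = Vᵀ * Jᵀ := transpose_mul _ _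
    rw [h1, ← Matrix.mul_assoc, trace_mul_comm]
    simp only [← Matrix.mul_assoc]
    rw [hJ, blkIncl_transpose_mul_mul, hAi, Matrix.one_mul]
  rw [finner_eq_trace, finner_eq_trace, transpose_mul, transpose_mul, transpose_transpose,
    transpose_transpose, transpose_add, Matrix.add_mul] at hle
  simp only [Matrix.mul_add, ← Matrix.mul_assoc, trace_add] at hle hcross hcross' hquad
  rw [Matrix.sub_mul, Matrix.one_mul, trace_sub, trace_sub]
  linarith

end Blocks

section Proximity

variable {n d : ℕ} {G R : Matrix (Fin n × Fin d) (Fin d) ℝ}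

lemma transpose_sub_mul_sub (hG : StiefelBlocks G) (hR : StiefelBlocks R)
    (hP : (Gᵀ * R).PosSemidef) :
    (R - G)ᵀ * (R - G) = (2 : ℝ) • ((n : ℝ) • (1 : Matrix (Fin d) (Fin d) ℝ) - Gᵀ * R) := by
  have hPT : Rᵀ * G = Gᵀ * R := by
    have := (isHermitian_iff_transpose _).1 hP.1
    rwa [transpose_mul, transpose_transpose] at this
  rw [transpose_sub, Matrix.sub_mul, Matrix.mul_sub, Matrix.mul_sub, hG.transpose_mul_self,
    hR.transpose_mul_self, hPT, two_smul]
  abel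

lemma transpose_add_mul_add (hG : StiefelBlocks G) (hR : StiefelBlocks R)
    (hP : (Gᵀ * R).PosSemidef) :
    (R + G)ᵀ * (R + G) = (2 : ℝ) • ((n : ℝ) • (1 : Matrix (Fin d) (Fin d) ℝ) + Gᵀ * R) := by
  have hPT : Rᵀ * G = Gᵀ * R := by
    have := (isHermitian_iff_transpose _).1 hP.1
    rwa [transpose_mul, transpose_transpose] at this
  rw [transpose_add, Matrix.add_mul, Matrix.mul_add, Matrix.mul_add, hG.transpose_mul_self,
    hR.transpose_mul_self, hPT, two_smul]
  abel

/-- An aligned point at least as good as the ground truth is close to it. -/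
lemma frobNorm_sub_le (hn : 0 < n) (hG : StiefelBlocks G) (hR : StiefelBlocks R)
    (hP : (Gᵀ * R).PosSemidef) {Δ : Matrix (Fin n × Fin d) (Fin n × Fin d) ℝ} (hΔ : Δ.IsSymm)
    (hle : finner (G * Gᵀ + Δ) (G * Gᵀ) ≤ finner (G * Gᵀ + Δ) (R * Rᵀ)) :
    frobNorm (R - G) ≤ 4 * Real.sqrt ((d : ℝ) / n) * opNorm Δ := by
  have hnR : (0 : ℝ) < n := by exact_mod_cast hn
  set D := frobNorm (R - G) with hD
  set P := Gᵀ * R with hPdef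
  have hPT : Rᵀ * G = P := by
    have := (isHermitian_iff_transpose _).1 hP.1
    rwa [hPdef, transpose_mul, transpose_transpose] at this
  have hE := transpose_sub_mul_sub hG hR hP
  have hF := transpose_add_mul_add hG hR hP
  have hDsq : D ^ 2 = 2 * (n * d - P.trace) := by
    rw [hD, frobNorm_sq_eq_trace, hE]
    simp [hPdef]
  have hFsq : frobNorm (R + G) ^ 2 ≤ (2 * Real.sqrt (n * d)) ^ 2 := by
    rw [mul_pow, Real.sq_sqrt (by positivity)]
    have : frobNorm (R + G) ^ 2 = 2 * (n * d + P.trace) := by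
      rw [frobNorm_sq_eq_trace, hF]
      simp [hPdef]
      ring
    nlinarith [sq_nonneg D]
  have hFle : frobNorm (R + G) ≤ 2 * Real.sqrt (n * d) :=
    le_of_sq_le_sq hFsq (by positivity)
  have hPP : (P * P).trace ≤ n * P.trace := by
    have hpsd : ((R - G)ᵀ * (R - G)).PosSemidef := by
      simpa [conjTranspose_eq_transpose_of_trivial] using
        posSemidef_conjTranspose_mul_self (R - G)
    have h := trace_mul_nonneg_of_posSemidef hP hpsd
    rw [hE, Matrix.mul_smul, trace_smul, Matrix.mul_sub, Matrix.mul_smul, Matrix.mul_one,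
      trace_sub, trace_smul, smul_eq_mul, smul_eq_mul] at h
    linarith
  have hval : ∀ S : Matrix (Fin n × Fin d) (Fin d) ℝ, finner (G * Gᵀ + Δ) (S * Sᵀ)
      = ((Sᵀ * G) * (Gᵀ * S)).trace + (Sᵀ * (Δ * S)).trace := by
    intro S
    rw [finner_eq_trace, transpose_mul, transpose_transpose, Matrix.add_mul, trace_add,
      ← Matrix.mul_assoc, trace_mul_comm, ← Matrix.mul_assoc Δ, trace_mul_comm (Δ * S)]
    simp only [Matrix.mul_assoc]
  have hsplit : ((R - G)ᵀ * (Δ * (R + G))).trace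
      = (Rᵀ * (Δ * R)).trace - (Gᵀ * (Δ * G)).trace := by
    have hc : (Rᵀ * (Δ * G)).trace = (Gᵀ * (Δ * R)).trace := by
      rw [← trace_transpose, transpose_mul, transpose_mul, transpose_transpose, hΔ.eq,
        Matrix.mul_assoc]
    rw [transpose_sub, Matrix.sub_mul, Matrix.mul_add, Matrix.mul_add, Matrix.mul_add, trace_sub,
      trace_add, trace_add, hc]
    ring
  have hcs : ((R - G)ᵀ * (Δ * (R + G))).trace ≤ D * (opNorm Δ * (2 * Real.sqrt (n * d))) :=
    (trace_transpose_mul_le_frobNorm _ _).trans (mul_le_mul_of_nonneg_left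
      ((frobNorm_mul_le _ _).trans (mul_le_mul_of_nonneg_left hFle (opNorm_nonneg _)))
      (frobNorm_nonneg _))
  rw [hval, hval, hG.transpose_mul_self, hPT, ← hPdef] at hle
  have hnn : (((n : ℝ) • (1 : Matrix (Fin d) (Fin d) ℝ)) * ((n : ℝ) • 1)).trace
      = n * (n * d) := by
    simp
  rw [hnn] at hle
  have hmain : n * D ^ 2 ≤ D * (4 * opNorm Δ * Real.sqrt (n * d)) := by
    rw [hDsq]
    linarith
  rcases (frobNorm_nonneg (R - G)).eq_or_lt with h0 | h0
  · rw [hD, ← h0]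
    have := opNorm_nonneg Δ
    positivity
  · have h1 : n * D ≤ 4 * opNorm Δ * Real.sqrt (n * d) := by
      rw [← hD] at h0
      nlinarith
    have h2 : Real.sqrt (n * d) = n * Real.sqrt ((d : ℝ) / n) := by
      have : (n * d : ℝ) = n ^ 2 * (d / n) := by field_simp
      rw [this, Real.sqrt_mul (by positivity), Real.sqrt_sq hnR.le]
    rw [h2] at h1
    refine le_of_mul_le_mul_left ?_ hnR
    linarith

end Proximity

lemma dotProduct_mulVec_eq_transpose_mulVec {m k : Type*} [Fintype m] [Fintype k] (X : Matrix m k ℝ)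
    (x : m → ℝ) (y : k → ℝ) : x ⬝ᵥ (X *ᵥ y) = (Xᵀ *ᵥ x) ⬝ᵥ y := by
  rw [dotProduct_mulVec, mulVec_transpose]

lemma vnorm_orthogonal_mulVec {m : Type*} [Fintype m] [DecidableEq m] {O : Matrix m m ℝ}
    (hO : Oᵀ * O = 1) (x : m → ℝ) : vnorm (O *ᵥ x) = vnorm x := by
  have : vnorm (O *ᵥ x) ^ 2 = vnorm x ^ 2 := by
    rw [vnorm_sq, vnorm_sq, dotProduct_mulVec_eq_transpose_mulVec, mulVec_mulVec, hO, one_mulVec]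
  exact (pow_left_inj₀ (vnorm_nonneg _) (vnorm_nonneg _) two_ne_zero).1 this

section Certificate

variable {n d : ℕ}

/-- The block diagonal Lagrange multiplier of (P) at `R`. -/
def multiplier (A : Matrix (Fin n × Fin d) (Fin n × Fin d) ℝ)
    (R : Matrix (Fin n × Fin d) (Fin d) ℝ) : Matrix (Fin n × Fin d) (Fin n × Fin d) ℝ :=
  ∑ i, blkIncl n d i * (rowBlk (A * R) i * (rowBlk R i)ᵀ) * (blkIncl n d i)ᵀ

variable {A : Matrix (Fin n × Fin d) (Fin n × Fin d) ℝ}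
  {R : Matrix (Fin n × Fin d) (Fin d) ℝ}

lemma multiplier_mul (hR : StiefelBlocks R) : multiplier A R * R = A * R := by
  rw [multiplier, Matrix.sum_mul]
  have : ∀ i, blkIncl n d i * (rowBlk (A * R) i * (rowBlk R i)ᵀ) * (blkIncl n d i)ᵀ * R
      = blkIncl n d i * (blkIncl n d i)ᵀ * (A * R) := by
    intro i
    rw [Matrix.mul_assoc, blkIncl_transpose_mul, Matrix.mul_assoc, Matrix.mul_assoc,
      mul_eq_one_comm.1 (hR i), Matrix.mul_one, Matrix.mul_assoc, blkIncl_transpose_mul]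
  rw [Finset.sum_congr rfl fun i _ => this i, ← Matrix.sum_mul, sum_blkIncl_mul_transpose,
    Matrix.one_mul]

lemma trace_multiplier_mul {X : Matrix (Fin n × Fin d) (Fin n × Fin d) ℝ}
    (hX : ∀ i, blk X i i = 1) :
    (multiplier A R * X).trace = ∑ i, (rowBlk (A * R) i * (rowBlk R i)ᵀ).trace := by
  rw [multiplier, Matrix.sum_mul, trace_sum]
  refine Finset.sum_congr rfl fun i _ => ?_
  rw [Matrix.mul_assoc, Matrix.mul_assoc, trace_mul_comm, Matrix.mul_assoc,
    blkIncl_transpose_mul_mul, hX, Matrix.mul_one]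

lemma transpose_multiplier
    (hN : ∀ i, (rowBlk (A * R) i * (rowBlk R i)ᵀ).PosSemidef) :
    (multiplier A R)ᵀ = multiplier A R := by
  rw [multiplier, transpose_sum]
  refine Finset.sum_congr rfl fun i _ => ?_
  rw [transpose_mul, transpose_mul, transpose_transpose,
    (isHermitian_iff_transpose _).1 (hN i).1]
  simp only [Matrix.mul_assoc]

lemma le_dotProduct_multiplier_mulVec {c : ℝ}
    (hN : ∀ i x, c * (x ⬝ᵥ x) ≤ x ⬝ᵥ ((rowBlk (A * R) i * (rowBlk R i)ᵀ) *ᵥ x))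
    (u : Fin n × Fin d → ℝ) : c * (u ⬝ᵥ u) ≤ u ⬝ᵥ (multiplier A R *ᵥ u) := by
  have h1 : u ⬝ᵥ ((1 : Matrix (Fin n × Fin d) (Fin n × Fin d) ℝ) *ᵥ u)
      = ∑ i, ((blkIncl n d i)ᵀ *ᵥ u) ⬝ᵥ ((blkIncl n d i)ᵀ *ᵥ u) := by
    rw [← sum_blkIncl_mul_transpose, sum_mulVec, dotProduct_sum]
    refine Finset.sum_congr rfl fun i _ => ?_
    rw [← mulVec_mulVec, dotProduct_mulVec_eq_transpose_mulVec]
  rw [one_mulVec] at h1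
  rw [h1, multiplier, sum_mulVec, dotProduct_sum, Finset.mul_sum]
  refine Finset.sum_le_sum fun i _ => ?_
  rw [← mulVec_mulVec, ← mulVec_mulVec, dotProduct_mulVec_eq_transpose_mulVec _ u]
  exact hN i _

lemma StiefelBlocks.sdpFeasible (hR : StiefelBlocks R) : sdpFeasible (R * Rᵀ) := by
  refine ⟨?_, ?_, fun i => ?_⟩
  · rw [IsSymm, transpose_mul, transpose_transpose]
  · simpa [conjTranspose_eq_transpose_of_trivial] using posSemidef_self_mul_conjTranspose R
  · rw [← hR i]
    ext k l
    simp [blk, rowBlk, mul_apply]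

/-- The orthogonal projection onto the complement of the column space of `R`. -/
def complProj (R : Matrix (Fin n × Fin d) (Fin d) ℝ) :
    Matrix (Fin n × Fin d) (Fin n × Fin d) ℝ := 1 - (n : ℝ)⁻¹ • (R * Rᵀ)

lemma transpose_complProj : (complProj R)ᵀ = complProj R := by
  simp [complProj]

lemma transpose_mul_complProj (hn : 0 < n) (hR : StiefelBlocks R) : Rᵀ * complProj R = 0 := by
  have hnR : (n : ℝ) ≠ 0 := by exact_mod_cast hn.ne'
  rw [complProj, Matrix.mul_sub, Matrix.mul_one, Matrix.mul_smul, ← Matrix.mul_assoc,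
    hR.transpose_mul_self, Matrix.smul_mul, Matrix.one_mul, smul_smul, inv_mul_cancel₀ hnR,
    one_smul, sub_self]

lemma complProj_mul_self (hn : 0 < n) (hR : StiefelBlocks R) :
    complProj R * complProj R = complProj R := by
  conv_lhs => rw [complProj, Matrix.sub_mul, Matrix.one_mul, Matrix.smul_mul, Matrix.mul_assoc]
  rw [← complProj, transpose_mul_complProj hn hR]
  simp

lemma posSemidef_complProj (hn : 0 < n) (hR : StiefelBlocks R) : (complProj R).PosSemidef := by
  rw [← complProj_mul_self hn hR]
  nth_rw 1 [← transpose_complProj]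
  simpa [conjTranspose_eq_transpose_of_trivial] using
    posSemidef_conjTranspose_mul_self (complProj R)

/-- A feasible `X` orthogonal to the complement of the column space of `R` equals `R * Rᵀ`. -/
lemma eq_mul_transpose_of_trace_complProj_mul_eq_zero (hn : 0 < n) (hR : StiefelBlocks R)
    {X : Matrix (Fin n × Fin d) (Fin n × Fin d) ℝ} (hX : sdpFeasible X)
    (h : (complProj R * X).trace = 0) : X = R * Rᵀ := by
  obtain ⟨hXs, hXp, hXb⟩ := hX
  have hXK : X * complProj R = 0 := by
    open scoped MatrixOrder in
    obtain ⟨B, hB⟩ := CStarAlgebra.nonneg_iff_eq_star_mul_self.mp hXp.nonneg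
    rw [star_eq_conjTranspose] at hB
    have h0 : ((B * complProj R)ᴴ * (B * complProj R)).trace = 0 := by
      rw [conjTranspose_mul, Matrix.mul_assoc, ← Matrix.mul_assoc Bᴴ, ← hB,
        conjTranspose_eq_transpose_of_trivial, transpose_complProj, ← Matrix.mul_assoc,
        trace_mul_comm, ← Matrix.mul_assoc, complProj_mul_self hn hR, h]
    rw [hB, Matrix.mul_assoc, trace_conjTranspose_mul_self_eq_zero_iff.1 h0, Matrix.mul_zero]
  have h1 : X = (n : ℝ)⁻¹ • (X * R * Rᵀ) := by
    rw [complProj, Matrix.mul_sub, Matrix.mul_one, Matrix.mul_smul, ← Matrix.mul_assoc,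
      sub_eq_zero] at hXK
    exact hXK
  have h2 : X = (n : ℝ)⁻¹ • (R * (Rᵀ * X)) := by
    conv_lhs => rw [← hXs.eq, h1]
    rw [transpose_smul, transpose_mul, transpose_mul, transpose_transpose, hXs.eq]
  obtain ⟨C, hC⟩ : ∃ C : Matrix (Fin d) (Fin d) ℝ, X = R * C * Rᵀ := by
    refine ⟨(n : ℝ)⁻¹ • (n : ℝ)⁻¹ • (Rᵀ * X * R), ?_⟩
    conv_lhs => rw [h1, h2]
    simp only [Matrix.smul_mul, Matrix.mul_smul, Matrix.mul_assoc]
  have i : Fin n := ⟨0, hn⟩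
  have h3 : rowBlk R i * C * (rowBlk R i)ᵀ = 1 := by
    rw [← hXb i, ← blkIncl_transpose_mul_mul, hC, ← blkIncl_transpose_mul, transpose_mul,
      transpose_transpose]
    simp only [Matrix.mul_assoc]
  have hRi := mul_eq_one_comm.1 (hR i)
  have h4 : C = 1 := by
    calc C = ((rowBlk R i)ᵀ * rowBlk R i) * C * ((rowBlk R i)ᵀ * rowBlk R i) := by
          rw [hRi, Matrix.one_mul, Matrix.mul_one]
      _ = (rowBlk R i)ᵀ * (rowBlk R i * C * (rowBlk R i)ᵀ) * rowBlk R i := by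
          simp only [Matrix.mul_assoc]
      _ = 1 := by rw [h3, Matrix.mul_one, hRi]
  rw [hC, h4, Matrix.mul_one]

/-- Dual certificate: if the multiplier dominates `A` strictly on the complement of the column
space of `R`, then `R * Rᵀ` is the only maximizer of the SDP relaxation. -/
lemma sdpMaximizer_of_certificate (hn : 0 < n) (hA : A.IsSymm) (hR : StiefelBlocks R)
    (hN : ∀ i, (rowBlk (A * R) i * (rowBlk R i)ᵀ).PosSemidef) {ε : ℝ} (hε : 0 < ε)
    (hv : ∀ v, Rᵀ *ᵥ v = 0 → ε * (v ⬝ᵥ v) ≤ v ⬝ᵥ ((multiplier A R - A) *ᵥ v)) :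
    sdpMaximizer A (R * Rᵀ) ∧ ∀ Y, sdpMaximizer A Y → Y = R * Rᵀ := by
  set L := multiplier A R - A with hL
  have hLT : Lᵀ = L := by rw [hL, transpose_sub, transpose_multiplier hN, hA.eq]
  have hLR : L * R = 0 := by rw [hL, Matrix.sub_mul, multiplier_mul hR, sub_self]
  set K := complProj R with hK
  have hKT : Kᵀ = K := transpose_complProj
  have hLK : L * K = L := by
    rw [hK, complProj, Matrix.mul_sub, Matrix.mul_smul, ← Matrix.mul_assoc, hLR]
    simp
  have hKL : K * L = L := by
    have := congrArg transpose hLK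
    rwa [transpose_mul, hLT, hKT] at this
  have hS : (L - ε • K).PosSemidef := by
    refine .of_dotProduct_mulVec_nonneg ?_ fun u => ?_
    · rw [isHermitian_iff_transpose, transpose_sub, transpose_smul, hLT, hKT]
    · have h := hv (K *ᵥ u) (by rw [mulVec_mulVec, transpose_mul_complProj hn hR, zero_mulVec])
      have h1 : (K *ᵥ u) ⬝ᵥ (K *ᵥ u) = u ⬝ᵥ (K *ᵥ u) := by
        rw [dotProduct_mulVec_eq_transpose_mulVec, hKT, mulVec_mulVec, complProj_mul_self hn hR,
          dotProduct_comm]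
      have h2 : (K *ᵥ u) ⬝ᵥ (L *ᵥ (K *ᵥ u)) = u ⬝ᵥ (L *ᵥ u) := by
        rw [mulVec_mulVec, hLK]
        nth_rw 1 [← hKT]
        rw [← dotProduct_mulVec_eq_transpose_mulVec, mulVec_mulVec, hKL]
      rw [h1, h2] at h
      rw [star_trivial, sub_mulVec, smul_mulVec, dotProduct_sub, dotProduct_smul, smul_eq_mul]
      linarith
  have hval : ∀ X, sdpFeasible X → finner A X
      = ∑ i, (rowBlk (A * R) i * (rowBlk R i)ᵀ).trace - (L * X).trace := by
    intro X hX
    rw [finner_eq_trace, hX.1.eq, ← trace_multiplier_mul hX.2.2, hL, Matrix.sub_mul, trace_sub]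
    ring
  have hLX : ∀ X, sdpFeasible X → ε * (K * X).trace ≤ (L * X).trace := by
    intro X hX
    have h := trace_mul_nonneg_of_posSemidef hS hX.2.1
    rw [Matrix.sub_mul, trace_sub, Matrix.smul_mul, trace_smul, smul_eq_mul] at h
    linarith
  have hKX : ∀ X, sdpFeasible X → 0 ≤ (K * X).trace := fun X hX =>
    trace_mul_nonneg_of_posSemidef (posSemidef_complProj hn hR) hX.2.1
  have hLRR : (L * (R * Rᵀ)).trace = 0 := by
    rw [← Matrix.mul_assoc, hLR, Matrix.zero_mul, trace_zero]
  refine ⟨⟨hR.sdpFeasible, fun Y hY => ?_⟩, fun Y hY => ?_⟩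
  · rw [hval Y hY, hval _ hR.sdpFeasible, hLRR]
    have := mul_nonneg hε.le (hKX Y hY)
    linarith [hLX Y hY]
  · refine eq_mul_transpose_of_trace_complProj_mul_eq_zero hn hR hY.1 (le_antisymm ?_ (hKX Y hY.1))
    have h := hY.2 _ hR.sdpFeasible
    rw [hval Y hY.1, hval _ hR.sdpFeasible, hLRR] at h
    have h2 := hLX Y hY.1
    by_contra! hpos
    have := mul_pos hε hpos
    linarith

end Certificate

/-- Lower bound on the stretching of the block multipliers at an aligned point. -/
lemma le_vnorm_rowBlk_mul {n d : ℕ} {G R : Matrix (Fin n × Fin d) (Fin d) ℝ}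
    (hG : StiefelBlocks G) (hR : StiefelBlocks R) (hP : (Gᵀ * R).PosSemidef)
    {Δ A : Matrix (Fin n × Fin d) (Fin n × Fin d) ℝ} (hΔ : Δ.IsSymm)
    (hA : A = G * Gᵀ + Δ)
    {a b : ℝ} {i : Fin n} (ha : opNorm ((colBlk Δ i)ᵀ * G) ≤ a) (hb : opNorm (colBlk Δ i) ≤ b)
    (x : Fin d → ℝ) :
    (n - frobNorm (R - G) ^ 2 / 2 - a - b * frobNorm (R - G)) * vnorm x
      ≤ vnorm ((rowBlk (A * R) i * (rowBlk R i)ᵀ) *ᵥ x) := by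
  set D := frobNorm (R - G) with hD
  set P := Gᵀ * R with hPdef
  set y := (rowBlk R i)ᵀ *ᵥ x with hy
  have hyx : vnorm y = vnorm x :=
    vnorm_orthogonal_mulVec (by rw [transpose_transpose]; exact hR i) x
  have hexp : vnorm ((R - G) *ᵥ y) ≤ D * vnorm y := vnorm_mulVec_le_frobNorm _ _
  have hPy : (n - D ^ 2 / 2) * vnorm y ≤ vnorm (P *ᵥ y) := by
    have h1 : ((R - G) *ᵥ y) ⬝ᵥ ((R - G) *ᵥ y) = 2 * (n * (y ⬝ᵥ y) - y ⬝ᵥ (P *ᵥ y)) := by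
      rw [dotProduct_mulVec_eq_transpose_mulVec, mulVec_mulVec, transpose_sub_mul_sub hG hR hP,
        dotProduct_comm, smul_mulVec, sub_mulVec, smul_mulVec, one_mulVec]
      simp [dotProduct_sub, hPdef]
    have h2 := pow_le_pow_left₀ (vnorm_nonneg _) hexp 2
    rw [vnorm_sq, h1, mul_pow, ← vnorm_sq] at h2
    have h3 := dotProduct_le_vnorm y (P *ᵥ y)
    rcases (vnorm_nonneg y).eq_or_lt with h0 | h0
    · rw [← h0, mul_zero]
      exact vnorm_nonneg _
    · refine le_of_mul_le_mul_left ?_ h0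
      linarith
  have hsplit : rowBlk G i *ᵥ (P *ᵥ y) = (rowBlk (A * R) i * (rowBlk R i)ᵀ) *ᵥ x
      + (-(((colBlk Δ i)ᵀ * G) *ᵥ y) + -((colBlk Δ i)ᵀ *ᵥ ((R - G) *ᵥ y))) := by
    have hcol : (colBlk Δ i)ᵀ = (blkIncl n d i)ᵀ * Δ := by
      rw [← mul_blkIncl, transpose_mul, hΔ.eq]
    have hΔi : rowBlk (A * R) i = rowBlk G i * P + (colBlk Δ i)ᵀ * R := by
      rw [hA, Matrix.add_mul, ← blkIncl_transpose_mul, ← blkIncl_transpose_mul, Matrix.mul_add,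
        hPdef, hcol]
      simp only [Matrix.mul_assoc]
    have hmul : (rowBlk (A * R) i * (rowBlk R i)ᵀ) *ᵥ x = rowBlk (A * R) i *ᵥ y := by
      rw [hy, mulVec_mulVec]
    rw [hmul, hΔi]
    simp only [add_mulVec, sub_mulVec, mulVec_sub, mulVec_mulVec]
    abel
  have hGP : vnorm (rowBlk G i *ᵥ (P *ᵥ y)) = vnorm (P *ᵥ y) :=
    vnorm_orthogonal_mulVec (mul_eq_one_comm.1 (hG i)) _
  have h1 : vnorm (((colBlk Δ i)ᵀ * G) *ᵥ y) ≤ a * vnorm y :=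
    (vnorm_mulVec_le _ _).trans (mul_le_mul_of_nonneg_right ha (vnorm_nonneg _))
  have h2 : vnorm ((colBlk Δ i)ᵀ *ᵥ ((R - G) *ᵥ y)) ≤ b * (D * vnorm y) :=
    (vnorm_transpose_mulVec_le _ _).trans (mul_le_mul hb hexp (vnorm_nonneg _)
      ((opNorm_nonneg _).trans hb))
  have h3 := vnorm_add_le ((rowBlk (A * R) i * (rowBlk R i)ᵀ) *ᵥ x)
    (-(((colBlk Δ i)ᵀ * G) *ᵥ y) + -((colBlk Δ i)ᵀ *ᵥ ((R - G) *ᵥ y)))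
  have h4 := vnorm_add_le (-(((colBlk Δ i)ᵀ * G) *ᵥ y)) (-((colBlk Δ i)ᵀ *ᵥ ((R - G) *ᵥ y)))
  rw [vnorm_neg, vnorm_neg] at h4
  rw [← hsplit, hGP] at h3
  rw [← hyx]
  linarith

/-- deterministic tightness of the SDP relaxation (Theorem 3.1 with δ = 4). -/
theorem sdp_tightness_deterministic {n d : ℕ} (hn : 2 ≤ n) (hd : 1 ≤ d)
    (Δ : Matrix (Fin n × Fin d) (Fin n × Fin d) ℝ)
    (hΔsym : Δ.IsSymm) (hΔdiag : ∀ i, blk Δ i i = 0)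
    (G : Matrix (Fin n × Fin d) (Fin d) ℝ) (hG : StiefelBlocks G)
    (A : Matrix (Fin n × Fin d) (Fin n × Fin d) ℝ) (hA : A = G * Gᵀ + Δ)
    (hcond : (n : ℝ) >
        24 * d * opNorm Δ ^ 2 / n
        + 4 * Real.sqrt ((d : ℝ) / n) * opNorm Δ * (⨆ i, opNorm (colBlk Δ i))
        + (⨆ i, opNorm ((colBlk Δ i)ᵀ * G))
        + opNorm Δ) :
    ∃ X : Matrix (Fin n × Fin d) (Fin n × Fin d) ℝ,
      sdpMaximizer A X ∧ (∀ Y, sdpMaximizer A Y → Y = X) ∧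
      X.rank = d ∧
      ∃ R : Matrix (Fin n × Fin d) (Fin d) ℝ, progPMaximizer A R ∧ X = R * Rᵀ := by
  have hn0 : 0 < n := by omega
  have hnR : (0 : ℝ) < n := by exact_mod_cast hn0
  obtain ⟨R, hR, hP⟩ := exists_aligned_progPMaximizer A G
  have hRG := hR.2 G hG
  rw [hA] at hRG
  have hD := frobNorm_sub_le hn0 hG hR.1 hP hΔsym hRG
  set D := frobNorm (R - G) with hDdef
  set a := ⨆ i, opNorm ((colBlk Δ i)ᵀ * G) with ha
  set b := ⨆ i, opNorm (colBlk Δ i) with hb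
  have hD0 : 0 ≤ D := frobNorm_nonneg _
  have hai : ∀ i, opNorm ((colBlk Δ i)ᵀ * G) ≤ a := le_ciSup (Set.finite_range _).bddAbove
  have hbi : ∀ i, opNorm (colBlk Δ i) ≤ b := le_ciSup (Set.finite_range _).bddAbove
  have hb0 : 0 ≤ b := (opNorm_nonneg _).trans (hbi ⟨0, hn0⟩)
  have hAsym : A.IsSymm := by
    rw [hA, IsSymm, transpose_add, transpose_mul, transpose_transpose, hΔsym.eq]
  have hAdiag : ∀ i, blk A i i = 1 := fun i => by
    rw [hA, ← blkIncl_transpose_mul_mul, Matrix.mul_add, Matrix.add_mul, blkIncl_transpose_mul_mul,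
      blkIncl_transpose_mul_mul, hΔdiag, add_zero]
    exact hG.sdpFeasible.2.2 i
  have hN : ∀ i, (rowBlk (A * R) i * (rowBlk R i)ᵀ).PosSemidef := fun i =>
    hR.posSemidef_rowBlk_mul hAsym (hAdiag i)
  have hNc : ∀ i x, (n - D ^ 2 / 2 - a - b * D) * (x ⬝ᵥ x)
      ≤ x ⬝ᵥ ((rowBlk (A * R) i * (rowBlk R i)ᵀ) *ᵥ x) := fun i =>
    PosSemidef.le_dotProduct_mulVec_of_le_vnorm (hN i)
      (le_vnorm_rowBlk_mul hG hR.1 hP hΔsym hA (hai i) (hbi i))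
  set ε := n - 3 / 2 * D ^ 2 - a - b * D - opNorm Δ with hεdef
  have hε : 0 < ε := by
    have h1 : D ^ 2 ≤ 16 * (d / n) * opNorm Δ ^ 2 := by
      refine (pow_le_pow_left₀ hD0 hD 2).trans_eq ?_
      rw [mul_pow, mul_pow, Real.sq_sqrt (by positivity)]
      norm_num
    have h2 := mul_le_mul_of_nonneg_left hD hb0
    have h3 : 24 * d * opNorm Δ ^ 2 / n = 3 / 2 * (16 * (d / n) * opNorm Δ ^ 2) := by ring
    rw [h3] at hcond
    linarith
  have hcert := sdpMaximizer_of_certificate hn0 hAsym hR.1 hN hε fun v hv => by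
    have h1 := le_dotProduct_multiplier_mulVec hNc v
    have h2 : v ⬝ᵥ (A *ᵥ v) ≤ (D ^ 2 + opNorm Δ) * (v ⬝ᵥ v) := by
      have h3 : Gᵀ *ᵥ v = -((R - G)ᵀ *ᵥ v) := by
        rw [transpose_sub, sub_mulVec, hv, zero_sub, neg_neg]
      have h4 : vnorm (Gᵀ *ᵥ v) ≤ D * vnorm v := by
        rw [h3, vnorm_neg, hDdef, ← frobNorm_transpose]
        exact vnorm_mulVec_le_frobNorm _ _
      have h5 := pow_le_pow_left₀ (vnorm_nonneg _) h4 2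
      have h6 := (dotProduct_le_vnorm v (Δ *ᵥ v)).trans
        (mul_le_mul_of_nonneg_left (vnorm_mulVec_le Δ v) (vnorm_nonneg v))
      rw [hA, add_mulVec, dotProduct_add, ← mulVec_mulVec,
        dotProduct_mulVec_eq_transpose_mulVec G v, ← vnorm_sq, ← vnorm_sq]
      linarith
    rw [sub_mulVec, dotProduct_sub, hεdef]
    linarith
  refine ⟨R * Rᵀ, hcert.1, hcert.2, ?_, R, hR, rfl⟩
  rw [rank_self_mul_transpose, ← rank_transpose_mul_self, hR.1.transpose_mul_self,
    rank_smul_of_mem_nonZeroDivisors _ (mem_nonZeroDivisors_of_ne_zero hnR.ne'), rank_one,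
    Fintype.card_fin]
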